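/- Let v ∈ F_q^{n-k} be a vector of full support (all coordinates nonzero), and let D_{n,k,v} be the [n,k;q] code generated by the matrix [I_k | M], where M is the k×(n-k) matrix whose first row is v and whose remaining k-1 rows are zero. Then for all p ∈ [0, (q-1)/q], P_ue(D_{n,k,v}, p) = (1-p)^{n-k+1} + (q-1)^{k-n} p^{n-k+1} - (1-p)^n. -/

import Mathlib

open scoped Classical

/-- Probability of undetected error on the q-ary symmetric channel:
`P_ue(C,p) = Σ_{c ∈ C, c ≠ 0} (p/(q-1))^{wt(c)} (1-p)^{n - wt(c)}`. -/
noncomputable def Pue {F : Type*} [Field F] [Fintype F] {n : ℕ}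
    (C : Submodule F (Fin n → F)) (p : ℝ) : ℝ :=
  ∑ c : C, if (c : Fin n → F) = 0 then 0 else
    (p / ((Fintype.card F : ℝ) - 1)) ^ hammingNorm (c : Fin n → F) *
      (1 - p) ^ (n - hammingNorm (c : Fin n → F))

/-- The linear map `x ↦ (x, x₁·v)`, i.e. `x ↦ x·[I_k | M]` where the first row of `M`
is `v` and the remaining rows are zero. -/
noncomputable def Dmap (F : Type*) [Field F] (n k : ℕ) (hk : 0 < k) (v : Fin (n - k) → F) :
    (Fin k → F) →ₗ[F] (Fin n → F) where
  toFun x := fun i =>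
    if h : (i : ℕ) < k then x ⟨i, h⟩
    else x ⟨0, hk⟩ * v ⟨(i : ℕ) - k, by have := i.isLt; omega⟩
  map_add' x y := by
    funext i
    by_cases h : (i : ℕ) < k <;> simp [h] <;> ring
  map_smul' t x := by
    funext i
    by_cases h : (i : ℕ) < k <;> simp [h] <;> ring

/-- The code `D_{n,k,v}` generated by `[I_k | M]`, where the first row of `M` is `v`
and the remaining `k-1` rows are zero. -/
noncomputable def Dcode (F : Type*) [Field F] (n k : ℕ) (hk : 0 < k) (v : Fin (n - k) → F) :
    Submodule F (Fin n → F) :=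
  LinearMap.range (Dmap F n k hk v)

/-- The factor contributed by a single coordinate to the channel weight of a codeword. -/
noncomputable def symbolWeight (F : Type*) [Field F] [Fintype F] (p : ℝ) (a : F) : ℝ :=
  if a = 0 then 1 - p else p / ((Fintype.card F : ℝ) - 1)

lemma prod_symbolWeight {F : Type*} [Field F] [Fintype F] {n : ℕ} (p : ℝ) (c : Fin n → F) :
    ∏ i, symbolWeight F p (c i) =
      (p / ((Fintype.card F : ℝ) - 1)) ^ hammingNorm c * (1 - p) ^ (n - hammingNorm c) := by
  have hcard : (Finset.univ.filter fun i => c i = 0).card = n - hammingNorm c := by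
    have h := Finset.card_filter_add_card_filter_not (s := Finset.univ) (fun i => c i = 0)
    simp only [Finset.card_univ, Fintype.card_fin] at h
    have h2 : hammingNorm c = (Finset.univ.filter fun i => ¬ c i = 0).card := by
      unfold hammingNorm
      congr
    omega
  have hcard' : (Finset.univ.filter fun i => ¬ c i = 0).card = hammingNorm c := by
    unfold hammingNorm
    congr
  simp only [symbolWeight, Finset.prod_ite, Finset.prod_const]
  rw [hcard, hcard', mul_comm]

lemma sum_symbolWeight_pow {F : Type*} [Field F] [Fintype F] (p : ℝ) (m : ℕ) :
    ∑ a : F, symbolWeight F p a ^ m =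
      (1 - p) ^ m + ((Fintype.card F : ℝ) - 1) * (p / ((Fintype.card F : ℝ) - 1)) ^ m := by
  rw [← Finset.add_sum_erase _ _ (Finset.mem_univ (0 : F))]
  have h : ∀ a ∈ Finset.univ.erase (0 : F),
      symbolWeight F p a ^ m = (p / ((Fintype.card F : ℝ) - 1)) ^ m := by
    intro a ha
    simp [symbolWeight, Finset.ne_of_mem_erase ha]
  rw [Finset.sum_congr rfl h, Finset.sum_const, Finset.card_erase_of_mem (Finset.mem_univ _),
    Finset.card_univ, nsmul_eq_mul, Nat.cast_sub Fintype.card_pos]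
  simp [symbolWeight]

lemma card_sub_one_ne_zero (F : Type*) [Field F] [Fintype F] :
    (Fintype.card F : ℝ) - 1 ≠ 0 := by
  have h : (1 : ℝ) < Fintype.card F := by exact_mod_cast Fintype.one_lt_card (α := F)
  linarith

lemma Pue_eq_sum_prod_sub {F : Type*} [Field F] [Fintype F] {n : ℕ}
    (C : Submodule F (Fin n → F)) (p : ℝ) :
    Pue C p = ∑ c : C, ∏ i, symbolWeight F p ((c : Fin n → F) i) - (1 - p) ^ n := by
  rw [Pue, ← Finset.add_sum_erase _ _ (Finset.mem_univ (0 : C)),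
    ← Finset.add_sum_erase _ (fun c : C => ∏ i, symbolWeight F p ((c : Fin n → F) i))
      (Finset.mem_univ (0 : C))]
  have h : ∀ c ∈ Finset.univ.erase (0 : C),
      (if (c : Fin n → F) = 0 then 0 else
        (p / ((Fintype.card F : ℝ) - 1)) ^ hammingNorm (c : Fin n → F) *
          (1 - p) ^ (n - hammingNorm (c : Fin n → F))) =
        ∏ i, symbolWeight F p ((c : Fin n → F) i) := by
    intro c hc
    have hc0 : (c : Fin n → F) ≠ 0 := by
      simpa using Finset.ne_of_mem_erase hc
    rw [if_neg hc0, prod_symbolWeight]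
  rw [Finset.sum_congr rfl h]
  simp [symbolWeight]

lemma Dmap_injective (F : Type*) [Field F] {n k : ℕ} (hk : 0 < k) (hkn : k ≤ n)
    (v : Fin (n - k) → F) : Function.Injective (Dmap F n k hk v) := by
  intro x y h
  funext i
  simpa [Dmap] using congrFun h (Fin.castLE hkn i)

lemma prod_symbolWeight_Dmap {F : Type*} [Field F] [Fintype F] {n k : ℕ} (hk : 0 < k)
    (hkn : k ≤ n) (v : Fin (n - k) → F) (hv : ∀ j, v j ≠ 0) (p : ℝ) (x : Fin k → F) :
    ∏ i, symbolWeight F p (Dmap F n k hk v x i) =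
      (∏ i, symbolWeight F p (x i)) * symbolWeight F p (x ⟨0, hk⟩) ^ (n - k) := by
  rw [← (finSumFinEquiv.trans (finCongr (Nat.add_sub_cancel' hkn))).prod_comp,
    Fintype.prod_sum_type]
  congr 1
  · simp [Dmap]
  · have h : ∀ a : F, ∀ j, symbolWeight F p (a * v j) = symbolWeight F p a := by
      intro a j
      simp [symbolWeight, hv j]
    simp [Dmap, h]

lemma sum_prod_symbolWeight_Dcode {F : Type*} [Field F] [Fintype F] {n k : ℕ} (hk : 0 < k)
    (hkn : k ≤ n) (v : Fin (n - k) → F) (hv : ∀ j, v j ≠ 0) (p : ℝ) :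
    ∑ c : Dcode F n k hk v, ∏ i, symbolWeight F p ((c : Fin n → F) i) =
      ∑ a : F, symbolWeight F p a ^ (n - k + 1) := by
  have hreindex : ∑ c : Dcode F n k hk v, ∏ i, symbolWeight F p ((c : Fin n → F) i) =
      ∑ x : Fin k → F, ∏ i, symbolWeight F p (Dmap F n k hk v x i) := by
    obtain ⟨e, he⟩ : ∃ e : (Fin k → F) ≃ Dcode F n k hk v,
        ∀ x, ((e x : Dcode F n k hk v) : Fin n → F) = Dmap F n k hk v x :=
      ⟨(LinearEquiv.ofInjective _ (Dmap_injective F hk hkn v)).toEquiv, fun x => rfl⟩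
    rw [← e.sum_comp]
    simp only [he]
  rw [hreindex]
  simp only [prod_symbolWeight_Dmap hk hkn v hv]
  obtain ⟨k, rfl⟩ := Nat.exists_eq_succ_of_ne_zero hk.ne'
  have hone : ∑ a : F, symbolWeight F p a = 1 := by
    have h := sum_symbolWeight_pow (F := F) p 1
    simp only [pow_one] at h
    rw [h, mul_div_cancel₀ _ (card_sub_one_ne_zero F)]
    ring
  rw [← (Fin.consEquiv fun _ => F).sum_comp, Fintype.sum_prod_type]
  refine Finset.sum_congr rfl fun a _ => ?_
  have hprod : ∑ y : Fin k → F, ∏ i, symbolWeight F p (y i) = 1 := by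
    rw [← Fintype.piFinset_univ, ← Finset.prod_univ_sum (fun _ => Finset.univ)
      (fun _ b => symbolWeight F p b)]
    simp [hone]
  have h0 : (⟨0, hk⟩ : Fin (k + 1)) = 0 := rfl
  simp only [Fin.consEquiv_apply, h0, Nat.succ_eq_add_one, Fin.prod_univ_succ, Fin.cons_zero,
    Fin.cons_succ]
  rw [← Finset.sum_mul, ← Finset.mul_sum, hprod]
  ring

/-- For the full-support code `D_{n,k,v}` with `v` of full support,
`P_ue(D_{n,k,v},p) = (1-p)^{n-k+1} + (q-1)^{k-n} p^{n-k+1} - (1-p)^n`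
for all `p ∈ [0,(q-1)/q]`. -/
theorem pue_Dcode_eq_full_support_bound {F : Type*} [Field F] [Fintype F] {n k q : ℕ}
    (hq : Fintype.card F = q) (hk : 0 < k) (hkn : k ≤ n)
    (v : Fin (n - k) → F) (hv : ∀ j, v j ≠ 0) :
    ∀ p : ℝ, 0 ≤ p → p ≤ ((q : ℝ) - 1) / q →
      Pue (Dcode F n k hk v) p = (1 - p) ^ (n - k + 1) +
        ((q : ℝ) - 1) ^ ((k : ℤ) - (n : ℤ)) * p ^ (n - k + 1) - (1 - p) ^ n := by
  intro p _ _
  subst hq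
  rw [Pue_eq_sum_prod_sub, sum_prod_symbolWeight_Dcode hk hkn v hv, sum_symbolWeight_pow]
  have hne := card_sub_one_ne_zero F
  have hexp : (k : ℤ) - n = -((n - k : ℕ) : ℤ) := by
    rw [Nat.cast_sub hkn]
    ring
  rw [hexp, zpow_neg, zpow_natCast, div_pow]
  field_simp
  ring
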